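/- Let R be a commutative noetherian semilocal normal domain admitting a non-commutative resolution, i.e., a finitely generated faithful R-module M such that End_R(M) has finite global dimension. Then the divisor class group Cl(R) is a finitely generated abelian group. -/

import Mathlib

section GlobalDimension

open Function

/-- `ProjDimLE A n M` says that the `A`-module `M` admits a projective resolution of
length at most `n`. -/
inductive ProjDimLE (A : Type) [Ring A] : ℕ → ModuleCat.{0} A → Prop
  | proj (M : ModuleCat.{0} A) (h : Module.Projective A M) : ProjDimLE A 0 M
  | step (n : ℕ) (M P : ModuleCat.{0} A) (hP : Module.Projective A P)
      (f : P →ₗ[A] M) (hf : Surjective f)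
      (h : ProjDimLE A n (ModuleCat.of A (LinearMap.ker f))) : ProjDimLE A (n + 1) M

/-- A ring has finite global dimension if there is a uniform finite bound on the
projective dimension of all (left) modules. -/
def HasFiniteGlobalDim (A : Type) [Ring A] : Prop :=
  ∃ n : ℕ, ∀ M : ModuleCat.{0} A, ProjDimLE A n M

end GlobalDimension
section DivisorClassGroup

/-- The height one primes of `R`. -/
def HeightOnePrime (R : Type) [CommRing R] : Type :=
  {p : PrimeSpectrum R // (Set.Iio p).chainHeight = 1}

/-- The order of vanishing of `f` at the prime `p`: the largest `n` such that `f` lies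
in the `n`-th power of the maximal ideal of `R_p` (a junk value for `f = 0`).  For a
noetherian normal domain and `p` of height one, `R_p` is a discrete valuation ring and
this is the usual valuation. -/
noncomputable def ordAt {R : Type} [CommRing R] (p : PrimeSpectrum R) (f : R) : ℕ :=
  sSup {n : ℕ | algebraMap R (Localization.AtPrime p.asIdeal) f ∈
    (Ideal.map (algebraMap R (Localization.AtPrime p.asIdeal)) p.asIdeal) ^ n}

/-- The subgroup of principal divisors: divisors of nonzero fractions `f/g`. -/
noncomputable def principalDivisors (R : Type) [CommRing R] :
    AddSubgroup (HeightOnePrime R →₀ ℤ) :=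
  AddSubgroup.closure {D | ∃ f g : R, f ≠ 0 ∧ g ≠ 0 ∧
    ∀ p : HeightOnePrime R, D p = (ordAt p.1 f : ℤ) - (ordAt p.1 g : ℤ)}

/-- The divisor class group `Cl(R)` of a (normal noetherian) domain: divisors (formal
`ℤ`-linear combinations of height one primes) modulo principal divisors. -/
abbrev DivClassGroup (R : Type) [CommRing R] : Type :=
  (HeightOnePrime R →₀ ℤ) ⧸ principalDivisors R

end DivisorClassGroup

section GenericClass

open Function

variable {R : Type} [CommRing R] {G : Type} [AddCommGroup G]

/-- `D` is additive on short exact sequences of finitely generated modules whose middle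
term satisfies `P`. -/
def IsAdditiveOn {A : Type} [Ring A] (P : ∀ (X : Type) [AddCommGroup X] [Module A X], Prop)
    (D : ∀ (X : Type) [AddCommGroup X] [Module A X], G) : Prop :=
  ∀ (X Y Z : Type) [AddCommGroup X] [Module A X] [AddCommGroup Y] [Module A Y]
    [AddCommGroup Z] [Module A Z] [Module.Finite A Y] (f : X →ₗ[A] Y) (g : Y →ₗ[A] Z),
    Injective f → Surjective g → Exact f g → P Y → D Y = D X + D Z

lemma IsAdditiveOn.congr {A : Type} [Ring A]
    {P : ∀ (X : Type) [AddCommGroup X] [Module A X], Prop}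
    {D : ∀ (X : Type) [AddCommGroup X] [Module A X], G} (hD : IsAdditiveOn P D)
    {X Y : Type} [AddCommGroup X] [Module A X] [AddCommGroup Y] [Module A Y]
    [Module.Finite A X] [Module.Finite A Y] (e : X ≃ₗ[A] Y) (hX : P X) (hY : P Y) :
    D X = D Y := by
  have h₁ : D PUnit = 0 := by
    have := hD X X PUnit LinearMap.id 0 injective_id (fun _ ↦ ⟨0, rfl⟩)
      (fun x ↦ ⟨fun _ ↦ ⟨x, rfl⟩, fun _ ↦ rfl⟩) hX
    simpa using this
  have := hD X Y PUnit e.toLinearMap 0 e.injective (fun _ ↦ ⟨0, rfl⟩)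
      (fun x ↦ ⟨fun _ ↦ e.surjective x, fun _ ↦ rfl⟩) hY
  rw [this, h₁, add_zero]

/-- `GenericClass D Y c` says that `c` is the value on `Y` of the extension of `D` from torsion
modules to all finitely generated modules, obtained by successively dividing out cyclic
submodules generated by non-torsion elements. -/
inductive GenericClass (D : ∀ (T : Type) [AddCommGroup T] [Module R T], G) :
    ∀ (Y : Type) [AddCommGroup Y] [Module R Y], G → Prop
  | torsion (T : Type) [AddCommGroup T] [Module R T] (hT : Module.IsTorsion R T) :
      GenericClass D T (D T)
  | step (Y Z : Type) [AddCommGroup Y] [Module R Y] [AddCommGroup Z] [Module R Z]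
      (g : Y →ₗ[R] Z) (hg : Surjective g) (y : Y) (hy : ∀ a : R, a • y = 0 → a = 0)
      (hker : LinearMap.ker g = Submodule.span R {y}) (c : G) (h : GenericClass D Z c) :
      GenericClass D Y c

variable [IsDomain R]

lemma finrank_lt_of_ker_eq_span [IsNoetherianRing R] {Y Z : Type} [AddCommGroup Y] [Module R Y]
    [AddCommGroup Z] [Module R Z] [Module.Finite R Y] (g : Y →ₗ[R] Z) (hg : Surjective g) (y : Y)
    (hy : ∀ a : R, a • y = 0 → a = 0) (hker : LinearMap.ker g = Submodule.span R {y}) :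
    Module.finrank R Z < Module.finrank R Y := by
  have h₁ := Submodule.finrank_quotient_add_finrank (LinearMap.ker g)
  rw [(g.quotKerEquivOfSurjective hg).finrank_eq] at h₁
  have : 0 < Module.finrank R (LinearMap.ker g) := by
    rw [Nat.pos_iff_ne_zero, Ne, Module.finrank_eq_zero_iff_isTorsion]
    intro h
    obtain ⟨a, ha⟩ := @h ⟨y, hker ▸ Submodule.mem_span_singleton_self y⟩
    exact nonZeroDivisors.coe_ne_zero a (hy a (congrArg Subtype.val ha))
  omega

lemma not_isTorsion_of_smul_eq_zero {Y : Type} [AddCommGroup Y] [Module R Y] (y : Y)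
    (hy : ∀ a : R, a • y = 0 → a = 0) : ¬ Module.IsTorsion R Y := fun h ↦ by
  obtain ⟨a, ha⟩ := @h y
  exact nonZeroDivisors.coe_ne_zero a (hy a ha)

lemma exists_smul_eq_zero_imp_of_not_isTorsion {Y : Type} [AddCommGroup Y] [Module R Y]
    (h : ¬ Module.IsTorsion R Y) : ∃ y : Y, ∀ a : R, a • y = 0 → a = 0 := by
  contrapose! h
  intro y
  obtain ⟨a, ha, ha'⟩ := h y
  exact ⟨⟨a, mem_nonZeroDivisors_of_ne_zero ha'⟩, ha⟩

namespace GenericClass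

variable {D : ∀ (T : Type) [AddCommGroup T] [Module R T], G}

omit [AddCommGroup G] in
lemma exists_class [IsNoetherianRing R] (Y : Type) [AddCommGroup Y] [Module R Y]
    [Module.Finite R Y] : ∃ c, GenericClass D Y c := by
  induction h : Module.finrank R Y using Nat.strong_induction_on generalizing Y with
  | _ n ih =>
    by_cases hY : Module.IsTorsion R Y
    · exact ⟨_, .torsion Y hY⟩
    · obtain ⟨y, hy⟩ := exists_smul_eq_zero_imp_of_not_isTorsion hY
      have hlt := finrank_lt_of_ker_eq_span (Submodule.span R {y}).mkQ
        (Submodule.mkQ_surjective _) y hy (Submodule.ker_mkQ _)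
      obtain ⟨c, hc⟩ := ih _ (h ▸ hlt) (Y ⧸ Submodule.span R {y}) rfl
      exact ⟨c, .step _ _ _ (Submodule.mkQ_surjective _) y hy (Submodule.ker_mkQ _) c hc⟩

omit [IsDomain R] in
lemma of_torsion_extension (hD : IsAdditiveOn (fun T _ _ ↦ Module.IsTorsion R T) D)
    {T Y Y' : Type} [AddCommGroup T] [Module R T] [AddCommGroup Y] [Module R Y]
    [AddCommGroup Y'] [Module R Y'] [Module.Finite R Y] (f : T →ₗ[R] Y) (g : Y →ₗ[R] Y')
    (hf : Injective f) (hg : Surjective g) (hfg : Exact f g) (hT : Module.IsTorsion R T)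
    {c : G} (h : GenericClass D Y' c) : GenericClass D Y (D T + c) := by
  induction h generalizing Y with
  | torsion Y' hY' =>
    have hY : Module.IsTorsion R Y := fun {y} ↦ by
      obtain ⟨a, ha⟩ := @hY' (g y)
      obtain ⟨t, ht⟩ := (hfg (a • y)).1 (by
        rw [← ha]; exact map_smul g (a : R) y)
      obtain ⟨b, hb⟩ := @hT t
      refine ⟨b * a, ?_⟩
      rw [mul_smul, ← ht]
      have := congrArg f hb
      rw [map_zero] at this
      rw [← this]
      exact (map_smul f (b : R) t).symm
    rw [← hD _ _ _ f g hf hg hfg hY]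
    exact .torsion Y hY
  | step Y' Z' g' hg' y' hy' hker c h ih =>
    obtain ⟨y, rfl⟩ := hg y'
    have hy : ∀ a : R, a • y = 0 → a = 0 := fun a ha ↦ hy' a (by rw [← map_smul, ha, map_zero])
    let π := (Submodule.span R {y}).mkQ
    have hle : Submodule.span R {y} ≤ LinearMap.ker (g' ∘ₗ g) := by
      rw [Submodule.span_singleton_le_iff_mem, LinearMap.mem_ker, LinearMap.comp_apply,
        ← LinearMap.mem_ker, hker]
      exact Submodule.mem_span_singleton_self _
    refine .step _ _ π (Submodule.mkQ_surjective _) y hy (Submodule.ker_mkQ _) _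
      (ih (π ∘ₗ f) ((Submodule.span R {y}).liftQ (g' ∘ₗ g) hle) ?_ ?_ ?_)
    · rw [injective_iff_map_eq_zero]
      intro t ht
      obtain ⟨a, ha⟩ := Submodule.mem_span_singleton.1 ((Submodule.Quotient.mk_eq_zero _).1 ht)
      have h0 : a = 0 := hy' a (by
        rw [← map_smul, ha]
        exact (hfg _).2 ⟨t, rfl⟩)
      apply hf
      rw [← ha, h0, zero_smul, map_zero]
    · intro z
      obtain ⟨w, rfl⟩ := hg' z
      obtain ⟨w, rfl⟩ := hg w
      exact ⟨π w, rfl⟩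
    · intro x
      obtain ⟨x, rfl⟩ := Submodule.mkQ_surjective _ x
      constructor
      · intro hx
        have hx : g x ∈ LinearMap.ker g' := hx
        rw [hker] at hx
        obtain ⟨a, ha⟩ := Submodule.mem_span_singleton.1 hx
        obtain ⟨t, ht⟩ := (hfg (x - a • y)).1 (by rw [map_sub, map_smul, ha, sub_self])
        refine ⟨t, ?_⟩
        change π (f t) = π x
        have : π y = 0 := (Submodule.Quotient.mk_eq_zero _).2 (Submodule.mem_span_singleton_self _)
        rw [ht, map_sub, map_smul, this, smul_zero, sub_zero]
      · rintro ⟨t, ht⟩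
        rw [← ht]
        change g' (g (f t)) = 0
        rw [(hfg _).2 ⟨t, rfl⟩, map_zero]

omit [IsDomain R] in
lemma of_extension (hD : IsAdditiveOn (fun T _ _ ↦ Module.IsTorsion R T) D)
    {X Y Z : Type} [AddCommGroup X] [Module R X] [AddCommGroup Y] [Module R Y]
    [AddCommGroup Z] [Module R Z] [Module.Finite R Y] (f : X →ₗ[R] Y) (g : Y →ₗ[R] Z)
    (hf : Injective f) (hg : Surjective g) (hfg : Exact f g)
    {c d : G} (h : GenericClass D X c) (h' : GenericClass D Z d) : GenericClass D Y (c + d) := by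
  induction h generalizing Y with
  | torsion X hX => exact of_torsion_extension hD f g hf hg hfg hX h'
  | step X X' q hq x hx hker c h ih =>
    have hy : ∀ a : R, a • f x = 0 → a = 0 := fun a ha ↦
      hx a (hf (by rw [map_smul, ha, map_zero]))
    let π := (Submodule.span R {f x}).mkQ
    have hle : Submodule.span R {f x} ≤ LinearMap.ker g := by
      rw [Submodule.span_singleton_le_iff_mem]
      exact (hfg _).2 ⟨x, rfl⟩
    have hle' : LinearMap.ker q ≤ LinearMap.ker (π ∘ₗ f) := by
      rw [hker, Submodule.span_singleton_le_iff_mem]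
      exact (Submodule.Quotient.mk_eq_zero _).2 (Submodule.mem_span_singleton_self _)
    let f' : X' →ₗ[R] Y ⧸ Submodule.span R {f x} :=
      (LinearMap.ker q).liftQ (π ∘ₗ f) hle' ∘ₗ (q.quotKerEquivOfSurjective hq).symm.toLinearMap
    have hf' : ∀ t, f' (q t) = π (f t) := fun t ↦ by
      have : (q.quotKerEquivOfSurjective hq).symm (q t) = Submodule.Quotient.mk t := by
        rw [LinearEquiv.symm_apply_eq]; rfl
      change (LinearMap.ker q).liftQ (π ∘ₗ f) hle' ((q.quotKerEquivOfSurjective hq).symm (q t)) = _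
      rw [this]; rfl
    refine .step _ _ π (Submodule.mkQ_surjective _) _ hy (Submodule.ker_mkQ _) _
      (ih f' ((Submodule.span R {f x}).liftQ g hle) ?_ ?_ ?_)
    · rw [injective_iff_map_eq_zero]
      intro t ht
      obtain ⟨t, rfl⟩ := hq t
      rw [hf'] at ht
      obtain ⟨a, ha⟩ := Submodule.mem_span_singleton.1 ((Submodule.Quotient.mk_eq_zero _).1 ht)
      rw [← map_smul] at ha
      rw [← LinearMap.mem_ker, hker, ← hf ha]
      exact Submodule.mem_span_singleton.2 ⟨a, rfl⟩
    · intro z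
      obtain ⟨w, rfl⟩ := hg z
      exact ⟨π w, rfl⟩
    · intro w
      obtain ⟨w, rfl⟩ := Submodule.mkQ_surjective _ w
      constructor
      · intro hw
        obtain ⟨t, ht⟩ := (hfg w).1 hw
        exact ⟨q t, by rw [hf', ht]⟩
      · rintro ⟨t, ht⟩
        obtain ⟨t, rfl⟩ := hq t
        rw [← ht, hf']
        exact (hfg _).2 ⟨t, rfl⟩

/-- Replacing a generator `y` of the cyclic kernel by a nonzero multiple does not change the class
of the quotient. -/
lemma of_smul [IsNoetherianRing R] (hD : IsAdditiveOn (fun T _ _ ↦ Module.IsTorsion R T) D)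
    (hD₀ : ∀ a : R, a ≠ 0 → D (R ⧸ Ideal.span {a}) = 0)
    {Y Z : Type} [AddCommGroup Y] [Module R Y] [AddCommGroup Z] [Module R Z] [Module.Finite R Y]
    (g : Y →ₗ[R] Z) (hg : Surjective g) (y : Y) (hy : ∀ a : R, a • y = 0 → a = 0)
    (hker : LinearMap.ker g = Submodule.span R {y}) {c : G} (h : GenericClass D Z c)
    (a : R) (ha : a ≠ 0) : GenericClass D (Y ⧸ Submodule.span R {a • y}) c := by
  let π := (Submodule.span R {a • y}).mkQ
  have hgy : g y = 0 := by
    rw [← LinearMap.mem_ker, hker]; exact Submodule.mem_span_singleton_self _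
  have hle : Submodule.span R {a • y} ≤ LinearMap.ker g := by
    rw [Submodule.span_singleton_le_iff_mem, LinearMap.mem_ker, map_smul, hgy, smul_zero]
  have hle' : Ideal.span {a} ≤ LinearMap.ker (π ∘ₗ LinearMap.toSpanSingleton R Y y) := by
    rw [Ideal.span, Submodule.span_singleton_le_iff_mem]
    refine (Submodule.Quotient.mk_eq_zero _).2 ?_
    rw [LinearMap.toSpanSingleton_apply]
    exact Submodule.mem_span_singleton_self _
  have key := of_torsion_extension hD ((Ideal.span {a}).liftQ _ hle')
    ((Submodule.span R {a • y}).liftQ g hle) ?_ ?_ ?_ ?_ h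
  · rwa [hD₀ a ha, zero_add] at key
  · rw [injective_iff_map_eq_zero]
    intro t ht
    obtain ⟨t, rfl⟩ := Submodule.mkQ_surjective _ t
    obtain ⟨b, hb⟩ := Submodule.mem_span_singleton.1 ((Submodule.Quotient.mk_eq_zero _).1 ht)
    rw [LinearMap.toSpanSingleton_apply, ← sub_eq_zero, smul_smul, ← sub_smul] at hb
    refine (Submodule.Quotient.mk_eq_zero _).2 (Ideal.mem_span_singleton'.2 ⟨b, ?_⟩)
    exact sub_eq_zero.1 (hy _ hb)
  · intro z
    obtain ⟨w, rfl⟩ := hg z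
    exact ⟨π w, rfl⟩
  · intro w
    obtain ⟨w, rfl⟩ := Submodule.mkQ_surjective _ w
    constructor
    · intro hw
      have hw : w ∈ LinearMap.ker g := hw
      rw [hker] at hw
      obtain ⟨b, hb⟩ := Submodule.mem_span_singleton.1 hw
      exact ⟨Submodule.Quotient.mk b, congrArg π hb⟩
    · rintro ⟨t, ht⟩
      obtain ⟨t, rfl⟩ := Submodule.mkQ_surjective _ t
      rw [← ht]
      change g (t • y) = 0
      rw [map_smul, hgy, smul_zero]
  · intro t
    refine ⟨⟨a, mem_nonZeroDivisors_of_ne_zero ha⟩, ?_⟩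
    obtain ⟨t, rfl⟩ := Submodule.mkQ_surjective _ t
    exact (Submodule.Quotient.mk_eq_zero _).2 (Ideal.mem_span_singleton'.2 ⟨t, mul_comm _ _⟩)

theorem unique [IsNoetherianRing R] (hD : IsAdditiveOn (fun T _ _ ↦ Module.IsTorsion R T) D)
    (hD₀ : ∀ a : R, a ≠ 0 → D (R ⧸ Ideal.span {a}) = 0)
    (Y : Type) [AddCommGroup Y] [Module R Y] [Module.Finite R Y] {c d : G}
    (h : GenericClass D Y c) (h' : GenericClass D Y d) : c = d := by
  induction hn : Module.finrank R Y using Nat.strong_induction_on generalizing Y c d with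
  | _ n ih =>
    subst hn
    cases h with
    | torsion _ hY =>
      cases h' with
      | torsion => rfl
      | step _ _ g' hg' y' hy' => exact absurd hY (not_isTorsion_of_smul_eq_zero y' hy')
    | step _ Z g hg y hy hker _ h =>
      cases h' with
      | torsion _ hY => exact absurd hY (not_isTorsion_of_smul_eq_zero y hy)
      | step _ Z' g' hg' y' hy' hker' _ h' =>
        have := Module.Finite.of_surjective g hg
        have := Module.Finite.of_surjective g' hg'
        by_cases hdep : ∃ a b : R, a ≠ 0 ∧ a • y = b • y'
        · obtain ⟨a, b, ha, hab⟩ := hdep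
          have hb : b ≠ 0 := by
            rintro rfl
            exact ha (hy a (by rw [hab, zero_smul]))
          have h₁ := of_smul hD hD₀ g hg y hy hker h a ha
          have h₂ := of_smul hD hD₀ g' hg' y' hy' hker' h' b hb
          rw [← hab] at h₂
          refine ih _ ?_ _ h₁ h₂ rfl
          refine finrank_lt_of_ker_eq_span (Submodule.span R {a • y}).mkQ
            (Submodule.mkQ_surjective _) _ (fun r hr ↦ ?_) (Submodule.ker_mkQ _)
          rw [smul_smul] at hr
          exact (mul_eq_zero.1 (hy _ hr)).resolve_right ha
        · push Not at hdep
          obtain ⟨e, he⟩ := exists_class (D := D) (Z ⧸ Submodule.span R {g y'})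
          have h₁ : GenericClass D Z e := by
            refine .step _ _ _ (Submodule.mkQ_surjective _) (g y') ?_ (Submodule.ker_mkQ _) _ he
            intro b hb
            rw [← map_smul, ← LinearMap.mem_ker, hker] at hb
            obtain ⟨a, ha⟩ := Submodule.mem_span_singleton.1 hb
            by_contra hb0
            have ha0 : a = 0 := by_contra fun h ↦ hdep a b h ha
            rw [ha0, zero_smul] at ha
            exact hb0 (hy' b ha.symm)
          have h₂ : GenericClass D Z' e := by
            have hle : LinearMap.ker g' ≤
                LinearMap.ker ((Submodule.span R {g y'}).mkQ ∘ₗ g) := by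
              rw [hker', Submodule.span_singleton_le_iff_mem]
              exact (Submodule.Quotient.mk_eq_zero _).2 (Submodule.mem_span_singleton_self _)
            let q : Z' →ₗ[R] Z ⧸ Submodule.span R {g y'} :=
              (LinearMap.ker g').liftQ _ hle ∘ₗ (g'.quotKerEquivOfSurjective hg').symm.toLinearMap
            have hq : ∀ w, q (g' w) = (Submodule.span R {g y'}).mkQ (g w) := fun w ↦ by
              have : (g'.quotKerEquivOfSurjective hg').symm (g' w) = Submodule.Quotient.mk w := by
                rw [LinearEquiv.symm_apply_eq]; rfl
              change (LinearMap.ker g').liftQ _ hle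
                ((g'.quotKerEquivOfSurjective hg').symm (g' w)) = _
              rw [this]; rfl
            refine .step _ _ q ?_ (g' y) ?_ ?_ _ he
            · intro z
              obtain ⟨z, rfl⟩ := Submodule.mkQ_surjective _ z
              obtain ⟨w, rfl⟩ := hg z
              exact ⟨g' w, hq w⟩
            · intro a ha
              rw [← map_smul, ← LinearMap.mem_ker, hker'] at ha
              obtain ⟨b, hb⟩ := Submodule.mem_span_singleton.1 ha
              by_contra ha0
              exact hdep a b ha0 hb.symm
            · ext w
              obtain ⟨w, rfl⟩ := hg' w
              rw [LinearMap.mem_ker, hq, ← LinearMap.mem_ker, Submodule.ker_mkQ,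
                Submodule.mem_span_singleton, Submodule.mem_span_singleton]
              constructor
              · rintro ⟨b, hb⟩
                rw [← sub_eq_zero, ← map_smul, ← map_sub, ← LinearMap.mem_ker, hker] at hb
                obtain ⟨a, ha⟩ := Submodule.mem_span_singleton.1 hb
                refine ⟨-a, ?_⟩
                have : g' y' = 0 := by
                  rw [← LinearMap.mem_ker, hker']; exact Submodule.mem_span_singleton_self _
                rw [← map_smul, neg_smul, ha, map_neg, map_sub, map_smul, this]
                simp
              · rintro ⟨a, ha⟩
                rw [← sub_eq_zero, ← map_smul, ← map_sub, ← LinearMap.mem_ker, hker'] at ha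
                obtain ⟨b, hb⟩ := Submodule.mem_span_singleton.1 ha
                refine ⟨-b, ?_⟩
                have : g y = 0 := by
                  rw [← LinearMap.mem_ker, hker]; exact Submodule.mem_span_singleton_self _
                rw [← map_smul, neg_smul, hb, map_neg, map_sub, map_smul, this]
                simp
          rw [ih _ (finrank_lt_of_ker_eq_span g hg y hy hker) Z h h₁ rfl,
            ih _ (finrank_lt_of_ker_eq_span g' hg' y' hy' hker') Z' h' h₂ rfl]

end GenericClass

/-- The extension of `D` from torsion modules to finitely generated modules. -/
noncomputable def extendClass (D : ∀ (T : Type) [AddCommGroup T] [Module R T], G)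
    (Y : Type) [AddCommGroup Y] [Module R Y] : G :=
  open Classical in if h : ∃ c, GenericClass D Y c then h.choose else 0

theorem exists_additive_extension [IsNoetherianRing R]
    (D : ∀ (T : Type) [AddCommGroup T] [Module R T], G)
    (hD : IsAdditiveOn (fun T _ _ ↦ Module.IsTorsion R T) D)
    (hD₀ : ∀ a : R, a ≠ 0 → D (R ⧸ Ideal.span {a}) = 0) :
    ∃ c : ∀ (Y : Type) [AddCommGroup Y] [Module R Y], G, IsAdditiveOn (fun _ _ _ ↦ True) c ∧
      ∀ (T : Type) [AddCommGroup T] [Module R T] [Module.Finite R T],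
        Module.IsTorsion R T → c T = D T := by
  have spec : ∀ (Y : Type) [AddCommGroup Y] [Module R Y] [Module.Finite R Y],
      GenericClass D Y (extendClass D Y) := fun Y _ _ _ ↦ by
    rw [extendClass, dif_pos (GenericClass.exists_class Y)]
    exact (GenericClass.exists_class Y).choose_spec
  refine ⟨fun Y _ _ ↦ extendClass D Y, ?_, ?_⟩
  · intro X Y Z _ _ _ _ _ _ _ f g hf hg hfg _
    have := Module.Finite.of_injective f hf
    have := Module.Finite.of_surjective g hg
    exact GenericClass.unique hD hD₀ Y (spec Y)
      (GenericClass.of_extension hD f g hf hg hfg (spec X) (spec Z))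
  · intro T _ _ _ hT
    exact GenericClass.unique hD hD₀ T (spec T) (.torsion T hT)

end GenericClass

section DivisorOfTorsionModule

open Function

/-- A finitely generated module annihilated by an ideal with artinian quotient is artinian. -/
lemma isArtinian_of_smul_eq_zero {B X : Type} [CommRing B] [AddCommGroup X] [Module B X]
    [Module.Finite B X] (I : Ideal B) [IsArtinianRing (B ⧸ I)]
    (h : ∀ a ∈ I, ∀ x : X, a • x = 0) : IsArtinian B X := by
  have ht : Module.IsTorsionBySet B X I := fun x a ↦ h a a.2 x
  let _ := ht.module
  have : IsScalarTower B (B ⧸ I) X := ht.isScalarTower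
  have : Module.Finite (B ⧸ I) X := Module.Finite.of_restrictScalars_finite B _ _
  exact isArtinian_of_surjective_algebraMap (R := B ⧸ I) Ideal.Quotient.mk_surjective

variable {R : Type} [CommRing R]

lemma sSup_setOf_mem_maximalIdeal_pow {B : Type} [CommRing B] [IsDomain B]
    [IsDiscreteValuationRing B] {x : B} (hx : x ≠ 0) :
    sSup {k : ℕ | x ∈ IsLocalRing.maximalIdeal B ^ k} = (Ring.ord B x).toNat := by
  obtain ⟨ϖ, hϖ⟩ := IsDiscreteValuationRing.exists_irreducible B
  obtain ⟨n, u, hu⟩ := IsDiscreteValuationRing.eq_unit_mul_pow_irreducible hx hϖ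
  rw [Ring.ord_eq_addVal, hu, IsDiscreteValuationRing.addVal_def' u hϖ n, ENat.toNat_natCast]
  have : {k : ℕ | (u : B) * ϖ ^ n ∈ IsLocalRing.maximalIdeal B ^ k} = Set.Iic n := by
    ext k
    rw [Set.mem_ofPred_eq, hϖ.maximalIdeal_eq, Ideal.span_singleton_pow, Ideal.mem_span_singleton,
      Set.mem_Iic, Units.dvd_mul_left, pow_dvd_pow_iff hϖ.ne_zero hϖ.not_isUnit]
  rw [this]
  exact csSup_Iic

namespace HeightOnePrime

lemma eq_of_lt [IsDomain R] (p : HeightOnePrime R) {q : PrimeSpectrum R} (hq : q < p.1) :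
    q.asIdeal = ⊥ := by
  have h : (Set.Iio p.1).encard = 1 := by
    have := congrFun p.2 (fun _ _ ↦ True)
    rwa [← Set.encard_eq_chainHeight_of_isChain _ (fun _ _ _ _ _ ↦ Or.inl trivial)] at this
  obtain ⟨x, hx⟩ := Set.encard_eq_one.1 h
  have hq' : q ∈ ({x} : Set (PrimeSpectrum R)) := hx ▸ hq
  have hb : (⊥ : PrimeSpectrum R) ∈ ({x} : Set (PrimeSpectrum R)) :=
    hx ▸ (lt_of_le_of_lt bot_le hq)
  have : q = ⊥ := (Set.mem_singleton_iff.1 hq').trans (Set.mem_singleton_iff.1 hb).symm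
  rw [this]; rfl

lemma ne_bot [IsDomain R] (p : HeightOnePrime R) : p.1.asIdeal ≠ ⊥ := by
  intro hp
  have h : (Set.Iio p.1).encard = 1 := by
    have := congrFun p.2 (fun _ _ ↦ True)
    rwa [← Set.encard_eq_chainHeight_of_isChain _ (fun _ _ _ _ _ ↦ Or.inl trivial)] at this
  obtain ⟨x, hx⟩ := Set.encard_eq_one.1 h
  have hx' : x < p.1 := by
    have : x ∈ Set.Iio p.1 := hx ▸ rfl
    exact this
  have hle : x.asIdeal < p.1.asIdeal := hx'
  rw [hp] at hle
  exact not_lt_bot hle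

lemma eq_of_le [IsDomain R] (p : HeightOnePrime R) {q : PrimeSpectrum R} (hq : q ≤ p.1)
    (hq0 : q.asIdeal ≠ ⊥) : q = p.1 :=
  hq.lt_or_eq.resolve_left fun h ↦ hq0 (p.eq_of_lt h)

lemma finite_setOf_mem [IsDomain R] [IsNoetherianRing R] {s : R} (hs : s ≠ 0) :
    {p : HeightOnePrime R | s ∈ p.1.asIdeal}.Finite := by
  refine Set.Finite.of_finite_image (f := fun p ↦ p.1.asIdeal)
    ((Ideal.finite_minimalPrimes_of_isNoetherianRing R (Ideal.span {s})).subset ?_)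
    (fun p _ q _ h ↦ Subtype.ext (PrimeSpectrum.ext h))
  rintro _ ⟨p, hp, rfl⟩
  refine ⟨⟨p.1.2, (Ideal.span_singleton_le_iff_mem _).2 hp⟩, ?_⟩
  rintro q ⟨hq, hsq⟩ hqp
  have := p.eq_of_le (q := ⟨q, hq⟩) hqp (fun h ↦ hs (by
    have : s ∈ q := hsq (Ideal.mem_span_singleton_self s)
    rwa [show q = ⊥ from h] at this))
  exact (congrArg PrimeSpectrum.asIdeal this).ge

lemma isDiscreteValuationRing [IsDomain R] [IsNoetherianRing R] [IsIntegrallyClosed R]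
    (p : HeightOnePrime R) : IsDiscreteValuationRing (Localization.AtPrime p.1.asIdeal) := by
  have hnf : ¬ IsField (Localization.AtPrime p.1.asIdeal) := by
    rw [IsLocalRing.isField_iff_maximalIdeal_eq, ← Localization.AtPrime.map_eq_maximalIdeal]
    intro h
    apply p.ne_bot
    rw [eq_bot_iff]
    intro x hx
    have := Ideal.mem_map_of_mem (algebraMap R (Localization.AtPrime p.1.asIdeal)) hx
    rw [h, Ideal.mem_bot] at this
    exact (IsLocalization.injective _ p.1.asIdeal.primeCompl_le_nonZeroDivisors)
      (this.trans (map_zero _).symm)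
  have hic : IsIntegrallyClosed (Localization.AtPrime p.1.asIdeal) :=
    isIntegrallyClosed_of_isLocalization _ p.1.asIdeal.primeCompl
      p.1.asIdeal.primeCompl_le_nonZeroDivisors
  have key : IsDiscreteValuationRing (Localization.AtPrime p.1.asIdeal) ↔
      IsIntegrallyClosed (Localization.AtPrime p.1.asIdeal) ∧
        ∃! P : Ideal (Localization.AtPrime p.1.asIdeal), P ≠ ⊥ ∧ P.IsPrime :=
    (IsDiscreteValuationRing.TFAE _ hnf).out 0 3
  refine key.2 ⟨hic, IsLocalRing.maximalIdeal _,
    ⟨fun h ↦ hnf (IsLocalRing.isField_iff_maximalIdeal_eq.2 h), inferInstance⟩, ?_⟩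
  rintro Q ⟨hQ, hQp⟩
  have hle : Q.under R ≤ p.1.asIdeal :=
    (Ideal.comap_mono (IsLocalRing.le_maximalIdeal hQp.ne_top)).trans
      Localization.AtPrime.under_maximalIdeal.le
  have hc : Q.under R = p.1.asIdeal :=
    congrArg PrimeSpectrum.asIdeal (p.eq_of_le (q := ⟨Q.under R, inferInstance⟩) hle fun h ↦ hQ (by
      have h : Q.under R = ⊥ := h
      rw [← IsLocalization.map_under p.1.asIdeal.primeCompl _ Q, h, Ideal.map_bot]))
  rw [← IsLocalization.map_under p.1.asIdeal.primeCompl _ Q, hc,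
    Localization.AtPrime.map_eq_maximalIdeal]

/-- The length of the localization of `T` at `p`. -/
noncomputable def mult (p : HeightOnePrime R) (T : Type) [AddCommGroup T] [Module R T] : ℕ :=
  (Module.length (Localization.AtPrime p.1.asIdeal)
    (LocalizedModule p.1.asIdeal.primeCompl T)).toNat

variable (p : HeightOnePrime R)

lemma subsingleton_localizedModule {T : Type} [AddCommGroup T] [Module R T] {s : R}
    (hs : s ∉ p.1.asIdeal) (h : ∀ t : T, s • t = 0) :
    Subsingleton (LocalizedModule p.1.asIdeal.primeCompl T) :=
  LocalizedModule.subsingleton_iff.2 fun t ↦ ⟨s, hs, h t⟩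

lemma mult_eq_zero {T : Type} [AddCommGroup T] [Module R T] {s : R}
    (hs : s ∉ p.1.asIdeal) (h : ∀ t : T, s • t = 0) : p.mult T = 0 := by
  have := p.subsingleton_localizedModule hs h
  rw [mult, Module.length_eq_zero, ENat.toNat_zero]

lemma length_ne_top [IsDomain R] [IsNoetherianRing R] [IsIntegrallyClosed R] {T : Type}
    [AddCommGroup T] [Module R T] [Module.Finite R T] {s : R} (hs : s ≠ 0)
    (h : ∀ t : T, s • t = 0) : Module.length (Localization.AtPrime p.1.asIdeal)
      (LocalizedModule p.1.asIdeal.primeCompl T) ≠ ⊤ := by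
  have := p.isDiscreteValuationRing
  let B := Localization.AtPrime p.1.asIdeal
  have hs' : algebraMap R B s ∈ nonZeroDivisors B := mem_nonZeroDivisors_of_ne_zero fun h0 ↦
    hs (IsLocalization.injective _ p.1.asIdeal.primeCompl_le_nonZeroDivisors
      (h0.trans (map_zero _).symm))
  have : Ring.KrullDimLE 1 B :=
    Ring.krullDimLE_one_iff_of_isPrime_bot.mpr fun I hI hI' ↦ hI'.isMaximal hI
  have : IsArtinianRing (B ⧸ Ideal.span {algebraMap R B s}) :=
    have := (isFiniteLength_iff_isNoetherian_isArtinian.1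
      (isFiniteLength_quotient_span_singleton B hs')).2
    isArtinian_of_tower B this
  have : IsArtinian B (LocalizedModule p.1.asIdeal.primeCompl T) := by
    refine isArtinian_of_smul_eq_zero (Ideal.span {algebraMap R B s}) ?_
    intro a ha x
    obtain ⟨b, rfl⟩ := Ideal.mem_span_singleton'.1 ha
    rw [mul_smul, algebraMap_smul]
    induction x using LocalizedModule.induction_on with
    | _ t u => rw [LocalizedModule.smul'_mk, h, LocalizedModule.zero_mk, smul_zero]
  exact Module.length_ne_top

lemma mult_eq_add [IsDomain R] [IsNoetherianRing R] [IsIntegrallyClosed R] {X Y Z : Type}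
    [AddCommGroup X] [Module R X] [AddCommGroup Y] [Module R Y] [AddCommGroup Z] [Module R Z]
    [Module.Finite R Y] (f : X →ₗ[R] Y) (g : Y →ₗ[R] Z) (hf : Injective f) (hg : Surjective g)
    (hfg : Exact f g) {s : R} (hs : s ≠ 0) (h : ∀ t : Y, s • t = 0) :
    p.mult Y = p.mult X + p.mult Z := by
  have := Module.Finite.of_injective f hf
  have := Module.Finite.of_surjective g hg
  have hX : ∀ t : X, s • t = 0 := fun t ↦ hf (by rw [map_smul, h, map_zero])
  have hZ : ∀ t : Z, s • t = 0 := fun t ↦ by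
    obtain ⟨t, rfl⟩ := hg t
    rw [← map_smul, h, map_zero]
  rw [mult, mult, mult, ← ENat.toNat_add (p.length_ne_top hs hX) (p.length_ne_top hs hZ)]
  congr 1
  exact Module.length_eq_add_of_exact (LocalizedModule.map p.1.asIdeal.primeCompl f)
    (LocalizedModule.map p.1.asIdeal.primeCompl g)
    (LocalizedModule.map_injective _ f hf) (LocalizedModule.map_surjective _ g hg)
    (LocalizedModule.map_exact _ f g hfg)

lemma mult_quotient (I : Ideal R) : p.mult (R ⧸ I) =
    (Module.length (Localization.AtPrime p.1.asIdeal) (Localization.AtPrime p.1.asIdeal ⧸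
      I.map (algebraMap R (Localization.AtPrime p.1.asIdeal)))).toNat := by
  let B := Localization.AtPrime p.1.asIdeal
  let q := Submodule.toLocalizedQuotient' B p.1.asIdeal.primeCompl (Algebra.linearMap R B) I
  have e := (IsLocalizedModule.linearEquiv p.1.asIdeal.primeCompl
    (LocalizedModule.mkLinearMap p.1.asIdeal.primeCompl (R ⧸ I)) q).extendScalarsOfIsLocalization
    p.1.asIdeal.primeCompl B
  rw [mult, e.length_eq, Ideal.localized'_eq_map]

lemma mult_self : p.mult (R ⧸ p.1.asIdeal) = 1 := by
  rw [mult_quotient, Localization.AtPrime.map_eq_maximalIdeal]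
  have : IsSimpleModule (Localization.AtPrime p.1.asIdeal) (Localization.AtPrime p.1.asIdeal ⧸
    IsLocalRing.maximalIdeal (Localization.AtPrime p.1.asIdeal)) :=
    isSimpleModule_iff_isCoatom.2 (Ideal.isMaximal_def.1 inferInstance)
  rw [Module.length_eq_one]; rfl

lemma mult_span_singleton [IsDomain R] [IsNoetherianRing R] [IsIntegrallyClosed R] {s : R}
    (hs : s ≠ 0) : p.mult (R ⧸ Ideal.span {s}) = ordAt p.1 s := by
  have := p.isDiscreteValuationRing
  let B := Localization.AtPrime p.1.asIdeal
  have hs' : algebraMap R B s ≠ 0 := fun h0 ↦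
    hs (IsLocalization.injective _ p.1.asIdeal.primeCompl_le_nonZeroDivisors
      (h0.trans (map_zero _).symm))
  rw [mult_quotient, Ideal.map_span, Set.image_singleton]
  rw [ordAt, Localization.AtPrime.map_eq_maximalIdeal]
  exact (sSup_setOf_mem_maximalIdeal_pow hs').symm

end HeightOnePrime

open HeightOnePrime

/-- The divisor of a finitely generated torsion module. -/
noncomputable def torsionDivisor (T : Type) [AddCommGroup T] [Module R T] :
    HeightOnePrime R →₀ ℤ :=
  open Classical in
  if h : (Function.support fun p : HeightOnePrime R ↦ (p.mult T : ℤ)).Finite then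
    Finsupp.ofSupportFinite _ h else 0

variable [IsDomain R] [IsNoetherianRing R]

lemma torsionDivisor_apply {T : Type} [AddCommGroup T] [Module R T] {s : R} (hs : s ≠ 0)
    (h : ∀ t : T, s • t = 0) (p : HeightOnePrime R) : torsionDivisor T p = p.mult T := by
  have hfin : (Function.support fun p : HeightOnePrime R ↦ (p.mult T : ℤ)).Finite :=
    (finite_setOf_mem hs).subset fun p hp ↦ by
      by_contra hsp
      exact hp (by simp [p.mult_eq_zero hsp h])
  rw [torsionDivisor, dif_pos hfin]
  rfl

omit [IsNoetherianRing R] in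
lemma exists_smul_eq_zero_of_isTorsion {T : Type} [AddCommGroup T] [Module R T]
    [Module.Finite R T] (hT : Module.IsTorsion R T) : ∃ s : R, s ≠ 0 ∧ ∀ t : T, s • t = 0 := by
  obtain ⟨s, hs, hs'⟩ := Submodule.annihilator_top_inter_nonZeroDivisors hT
  exact ⟨s, nonZeroDivisors.ne_zero hs', fun t ↦
    (Submodule.mem_annihilator.1 hs) t Submodule.mem_top⟩

variable [IsIntegrallyClosed R]

lemma isAdditiveOn_torsionDivisor :
    IsAdditiveOn (A := R) (fun T _ _ ↦ Module.IsTorsion R T)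
      (fun T _ _ ↦ torsionDivisor (R := R) T) := by
  intro X Y Z _ _ _ _ _ _ _ f g hf hg hfg hY
  obtain ⟨s, hs, h⟩ := exists_smul_eq_zero_of_isTorsion hY
  have hX : ∀ t : X, s • t = 0 := fun t ↦ hf (by rw [map_smul, h, map_zero])
  have hZ : ∀ t : Z, s • t = 0 := fun t ↦ by
    obtain ⟨t, rfl⟩ := hg t
    rw [← map_smul, h, map_zero]
  ext p
  rw [Finsupp.add_apply, torsionDivisor_apply hs h, torsionDivisor_apply hs hX,
    torsionDivisor_apply hs hZ, p.mult_eq_add f g hf hg hfg hs h, Nat.cast_add]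

lemma torsionDivisor_span_singleton {s : R} (hs : s ≠ 0) :
    torsionDivisor (R ⧸ Ideal.span {s}) ∈ principalDivisors R := by
  refine AddSubgroup.subset_closure ⟨s, 1, hs, one_ne_zero, fun p ↦ ?_⟩
  have h₁ : ordAt p.1 (1 : R) = 0 := by
    rw [← p.mult_span_singleton one_ne_zero]
    refine p.mult_eq_zero (s := 1) p.1.asIdeal.one_notMem fun t ↦ ?_
    obtain ⟨t, rfl⟩ := Submodule.mkQ_surjective _ t
    exact (Submodule.Quotient.mk_eq_zero _).2 (Ideal.mem_span_singleton.2 (one_dvd _))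
  rw [torsionDivisor_apply hs, p.mult_span_singleton hs, h₁, Nat.cast_zero, sub_zero]
  intro t
  obtain ⟨t, rfl⟩ := Submodule.mkQ_surjective _ t
  exact (Submodule.Quotient.mk_eq_zero _).2 (Ideal.mem_span_singleton'.2 ⟨t, mul_comm _ _⟩)

omit [IsIntegrallyClosed R] in
lemma torsionDivisor_quotient_prime (q : HeightOnePrime R) :
    torsionDivisor (R ⧸ q.1.asIdeal) = Finsupp.single q 1 := by
  have key : ∀ s ∈ q.1.asIdeal, ∀ t : R ⧸ q.1.asIdeal, s • t = 0 := fun s hs t ↦ by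
    obtain ⟨t, rfl⟩ := Submodule.mkQ_surjective _ t
    exact (Submodule.Quotient.mk_eq_zero _).2 (Ideal.mul_mem_right _ _ hs)
  obtain ⟨s, hs, hs0⟩ := Submodule.exists_mem_ne_zero_of_ne_bot q.ne_bot
  ext p
  rw [torsionDivisor_apply hs0 (key s hs)]
  by_cases hpq : q = p
  · subst hpq
    rw [Finsupp.single_eq_same, mult_self, Nat.cast_one]
  · rw [Finsupp.single_eq_of_ne' hpq]
    have : ¬ q.1.asIdeal ≤ p.1.asIdeal := fun h ↦ hpq (Subtype.ext (p.eq_of_le h q.ne_bot))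
    obtain ⟨a, ha, hap⟩ := SetLike.not_le_iff_exists.1 this
    rw [p.mult_eq_zero hap (key a ha), Nat.cast_zero]

end DivisorOfTorsionModule

section ProjectiveDimension

open CategoryTheory

variable {A : Type} [Ring A] {G : Type} [AddCommGroup G]

/-- The subgroup generated by the values of `φ` on finitely generated projective modules. -/
def projectiveValues (φ : ∀ (X : Type) [AddCommGroup X] [Module A X], G) : AddSubgroup G :=
  AddSubgroup.closure {c | ∃ (P : Type) (_ : AddCommGroup P) (_ : Module A P),
    Module.Finite A P ∧ Module.Projective A P ∧ φ P = c}

lemma ProjDimLE.hasProjectiveDimensionLT {n : ℕ} {M : ModuleCat.{0} A} (h : ProjDimLE A n M) :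
    HasProjectiveDimensionLT M (n + 1) := by
  induction h with
  | proj M h =>
    have := (IsProjective.iff_projective M).1 h
    exact projective_iff_hasProjectiveDimensionLT_one.1 this
  | step n M P hP f hf _ ih =>
    have := (IsProjective.iff_projective P).1 hP
    have : HasProjectiveDimensionLT (ModuleCat.of A P) 1 :=
      projective_iff_hasProjectiveDimensionLT_one.1 this
    exact (LinearMap.shortExact_shortComplexKer hf).hasProjectiveDimensionLT_X₃ (n + 1) ih
      (hasProjectiveDimensionLT_of_ge _ 1 _ (by lia))

variable [IsNoetherianRing A] {φ : ∀ (X : Type) [AddCommGroup X] [Module A X], G}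

lemma mem_projectiveValues_of_hasProjectiveDimensionLT
    (hφ : IsAdditiveOn (A := A) (fun _ _ _ ↦ True) φ) (n : ℕ) (X : Type) [AddCommGroup X]
    [Module A X] [Module.Finite A X]
    (h : HasProjectiveDimensionLT (ModuleCat.of A X) (n + 1)) : φ X ∈ projectiveValues φ := by
  induction n generalizing X with
  | zero =>
    have : Module.Projective A X := (IsProjective.iff_projective X).2
      (projective_iff_hasProjectiveDimensionLT_one.2 h)
    exact AddSubgroup.subset_closure ⟨X, _, _, inferInstance, this, rfl⟩
  | succ n ih =>
    obtain ⟨k, f, hf⟩ := Module.Finite.exists_fin' A X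
    have hP : HasProjectiveDimensionLT (ModuleCat.of A (Fin k → A)) 1 :=
      projective_iff_hasProjectiveDimensionLT_one.1
        ((IsProjective.iff_projective (Fin k → A)).1 inferInstance)
    have hker := ih (LinearMap.ker f)
      ((LinearMap.shortExact_shortComplexKer hf).hasProjectiveDimensionLT_X₁ (n + 1)
        (hasProjectiveDimensionLT_of_ge _ 1 _ (by lia)) h)
    have hfree : φ (Fin k → A) ∈ projectiveValues φ :=
      AddSubgroup.subset_closure ⟨_, _, _, inferInstance, inferInstance, rfl⟩
    have := hφ _ _ _ (LinearMap.ker f).subtype f (LinearMap.ker f).injective_subtype hf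
      (LinearMap.exact_subtype_ker_map f) trivial
    rw [eq_sub_of_add_eq' this.symm]
    exact sub_mem hfree hker

lemma HasFiniteGlobalDim.mem_projectiveValues (hA : HasFiniteGlobalDim A)
    (hφ : IsAdditiveOn (A := A) (fun _ _ _ ↦ True) φ) (X : Type) [AddCommGroup X]
    [Module A X] [Module.Finite A X] : φ X ∈ projectiveValues φ := by
  obtain ⟨n, hn⟩ := hA
  exact mem_projectiveValues_of_hasProjectiveDimensionLT hφ n X (hn _).hasProjectiveDimensionLT

end ProjectiveDimension

section Semilocal

open Function

variable {A : Type} [Ring A]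

lemma isScalarTower_compHom {R : Type} [CommRing R] [Algebra R A] (X : Type) [AddCommGroup X]
    [Module A X] :
    let _ : Module R X := Module.compHom X (algebraMap R A)
    IsScalarTower R A X :=
  let _ : Module R X := Module.compHom X (algebraMap R A)
  ⟨fun r a x ↦ by
    change (r • a) • x = algebraMap R A r • a • x
    rw [Algebra.smul_def, mul_smul]⟩

lemma isSemisimpleModule_quotient_jacobson {R : Type} [CommRing R] [IsNoetherianRing R]
    [Algebra R A] [Module.Finite R A] (hR : {I : Ideal R | I.IsMaximal}.Finite) (P : Type)
    [AddCommGroup P] [Module A P] [Module.Finite A P] :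
    IsSemisimpleModule A (P ⧸ Module.jacobson A P) := by
  let J : Ideal R := Ideal.jacobson ⊥
  have : IsArtinianRing (R ⧸ J) := by
    have := hR.to_subtype
    let f : R →ₗ[R] (∀ I : {I : Ideal R | I.IsMaximal}, R ⧸ I.1) :=
      LinearMap.pi fun I ↦ Submodule.mkQ I.1
    have hf : LinearMap.ker f = J := by
      ext x
      simp only [f, J, LinearMap.ker_pi, Submodule.ker_mkQ, Ideal.jacobson, Submodule.mem_iInf,
        bot_le, true_and, Submodule.mem_sInf, Set.mem_ofPred_eq, Subtype.forall]
    have (I : {I : Ideal R | I.IsMaximal}) : IsSimpleModule R (R ⧸ I.1) :=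
      isSimpleModule_iff_isCoatom.2 (Ideal.isMaximal_def.1 I.2)
    have : IsArtinian R (R ⧸ J) := isArtinian_of_injective (Submodule.liftQ J f hf.ge)
      (LinearMap.ker_eq_bot.1 (Submodule.ker_liftQ_eq_bot _ _ _ hf.le))
    exact isArtinian_of_tower R this
  let T := P ⧸ Module.jacobson A P
  let _ : Module R P := Module.compHom P (algebraMap R A)
  have : IsScalarTower R A P := isScalarTower_compHom P
  have : Module.Finite R P := Module.Finite.trans A P
  have key : ∀ r ∈ J, ∀ x : P, r • x ∈ Module.jacobson A P := by
    intro r hr x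
    refine Submodule.mem_sInf.2 fun N hN ↦ ?_
    have : IsSimpleModule A (P ⧸ N) := isSimpleModule_iff_isCoatom.2 hN
    let μ : (P ⧸ N) →ₗ[A] (P ⧸ N) :=
      { toFun y := r • y
        map_add' := smul_add r
        map_smul' a y := by
          rw [← algebraMap_smul A r, ← algebraMap_smul A r, RingHom.id_apply, smul_smul,
            smul_smul, Algebra.commutes] }
    rcases LinearMap.surjective_or_eq_zero μ with h | h
    · exfalso
      have hbot := Submodule.eq_bot_of_le_smul_of_le_jacobson_bot J (⊤ : Submodule R (P ⧸ N))
        (Module.Finite.fg_top) (fun y _ ↦ by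
          obtain ⟨z, rfl⟩ := h y
          exact Submodule.smul_mem_smul hr trivial) le_rfl
      have := IsSimpleModule.nontrivial A (P ⧸ N)
      obtain ⟨y, hy⟩ := exists_ne (0 : P ⧸ N)
      exact hy ((Submodule.mem_bot R).1 (hbot ▸ Submodule.mem_top))
    · have := LinearMap.congr_fun h (N.mkQ x)
      exact (Submodule.Quotient.mk_eq_zero N).1 this
  have : IsArtinian R T := isArtinian_of_smul_eq_zero J fun r hr x ↦ by
    obtain ⟨x, rfl⟩ := Submodule.mkQ_surjective _ x
    exact (Submodule.Quotient.mk_eq_zero _).2 (key r hr x)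
  have : IsArtinian A T := isArtinian_of_tower R this
  exact (IsArtinian.isSemisimpleModule_iff_jacobson A T).2 (Module.jacobson_quotient_jacobson A P)

lemma eq_top_of_sup_eq_top_of_le_jacobson {P : Type} [AddCommGroup P] [Module A P]
    [Module.Finite A P] {N K : Submodule A P} (hK : K ≤ Module.jacobson A P) (h : N ⊔ K = ⊤) :
    N = ⊤ := by
  by_contra hN
  obtain ⟨C, hC, hNC⟩ := (eq_top_or_exists_le_coatom N).resolve_left hN
  exact hC.1 (top_le_iff.1 (h ▸ sup_le hNC (hK.trans (sInf_le hC))))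

variable (A) {k : ℕ} (S : Fin k → Type) [∀ j, AddCommGroup (S j)] [∀ j, Module A (S j)]

/-- `HasTop A S P n` says that `P` surjects, with kernel in its Jacobson radical, onto a finite
direct sum of modules `S j`, in which each `S j` appears `n j` times. -/
def HasTop (P : Type) [AddCommGroup P] [Module A P] (n : Fin k → ℤ) : Prop :=
  ∃ (ι : Type) (_ : Fintype ι) (σ : ι → Fin k) (π : P →ₗ[A] (∀ i, S (σ i))),
    Surjective π ∧ LinearMap.ker π ≤ Module.jacobson A P ∧ n = ∑ i, Pi.single (σ i) 1

variable {A S}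

lemma HasTop.prod {P Q : Type} [AddCommGroup P] [Module A P] [AddCommGroup Q] [Module A Q]
    {n m : Fin k → ℤ} (hP : HasTop A S P n) (hQ : HasTop A S Q m) : HasTop A S (P × Q) (n + m) := by
  obtain ⟨ι, _, σ, π, hπ, hπ', rfl⟩ := hP
  obtain ⟨κ, _, τ, ρ, hρ, hρ', rfl⟩ := hQ
  let e := LinearEquiv.sumPiEquivProdPi A ι κ (fun i ↦ S (Sum.elim σ τ i))
  refine ⟨ι ⊕ κ, inferInstance, Sum.elim σ τ, e.symm.toLinearMap ∘ₗ (π.prodMap ρ), ?_, ?_, ?_⟩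
  · exact e.symm.surjective.comp (hπ.prodMap hρ)
  · rintro ⟨x, y⟩ hxy
    obtain ⟨hx, hy⟩ := Prod.ext_iff.1 (e.symm.injective (hxy.trans (map_zero e.symm).symm))
    have h₁ := Module.map_jacobson_le (LinearMap.inl A P Q) (Submodule.mem_map_of_mem (hπ' hx))
    have h₂ := Module.map_jacobson_le (LinearMap.inr A P Q) (Submodule.mem_map_of_mem (hρ' hy))
    simpa using add_mem h₁ h₂
  · simp [Fintype.sum_sum_type]

lemma card_fiber_eq_sum_single {ι : Type} [Fintype ι] (σ : ι → Fin k) (j : Fin k) :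
    (∑ i, Pi.single (σ i) 1 : Fin k → ℤ) j = Fintype.card {i // σ i = j} := by
  simp [Finset.sum_apply, Pi.single_apply, Fintype.card_subtype, eq_comm]

lemma exists_linearEquiv_pi_of_sum_single_eq {ι κ : Type} [Fintype ι] [Fintype κ]
    {σ : ι → Fin k} {τ : κ → Fin k}
    (h : (∑ i, Pi.single (σ i) 1 : Fin k → ℤ) = ∑ i, Pi.single (τ i) 1) :
    Nonempty ((∀ i, S (σ i)) ≃ₗ[A] (∀ i, S (τ i))) := by
  have hc (j : Fin k) : Fintype.card {i // σ i = j} = Fintype.card {i // τ i = j} := by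
    have := congrFun h j
    rw [card_fiber_eq_sum_single, card_fiber_eq_sum_single] at this
    exact_mod_cast this
  let e : ι ≃ κ := Equiv.ofFiberEquiv fun j ↦ Fintype.equivOfCardEq (hc j)
  have he : ∀ i, τ (e i) = σ i := Equiv.ofFiberEquiv_map _
  have hcast {a b : Fin k} (hab : a = b) : Nonempty (S b ≃ₗ[A] S a) := by
    subst hab
    exact ⟨LinearEquiv.refl A _⟩
  exact ⟨(LinearEquiv.piCongrRight fun i ↦ (hcast (he i)).some).trans
    (LinearEquiv.piCongrLeft A (fun i ↦ S (τ i)) e)⟩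

lemma HasTop.nonempty_linearEquiv [IsNoetherianRing A] {P Q : Type} [AddCommGroup P] [Module A P]
    [AddCommGroup Q] [Module A Q] [Module.Finite A P] [Module.Finite A Q] [Module.Projective A P]
    [Module.Projective A Q] {n : Fin k → ℤ} (hP : HasTop A S P n) (hQ : HasTop A S Q n) :
    Nonempty (P ≃ₗ[A] Q) := by
  obtain ⟨ι, _, σ, π, hπ, hπ', rfl⟩ := hP
  obtain ⟨κ, _, τ, ρ, hρ, hρ', h⟩ := hQ
  obtain ⟨e⟩ := exists_linearEquiv_pi_of_sum_single_eq (A := A) (S := S) h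
  have lift {P Q V : Type} [AddCommGroup P] [Module A P] [AddCommGroup Q] [Module A Q]
      [AddCommGroup V] [Module A V] [Module.Finite A Q] [Module.Projective A P]
      (π : P →ₗ[A] V) (ρ : Q →ₗ[A] V) (hπ : Surjective π) (hρ : Surjective ρ)
      (hρ' : LinearMap.ker ρ ≤ Module.jacobson A Q) : ∃ f : P →ₗ[A] Q, Surjective f := by
    obtain ⟨f, hf⟩ := Module.projective_lifting_property ρ π hρ
    refine ⟨f, LinearMap.range_eq_top.1 (eq_top_of_sup_eq_top_of_le_jacobson hρ' ?_)⟩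
    refine eq_top_iff.2 fun y _ ↦ ?_
    obtain ⟨x, hx⟩ := hπ (ρ y)
    rw [← hf, LinearMap.comp_apply] at hx
    rw [← add_sub_cancel (f x) y]
    exact Submodule.add_mem_sup ⟨x, rfl⟩ (by simp [hx])
  obtain ⟨f, hf⟩ := lift (e.toLinearMap ∘ₗ π) ρ (e.surjective.comp hπ) hρ hρ'
  obtain ⟨g, hg⟩ := lift ρ (e.toLinearMap ∘ₗ π) hρ (e.surjective.comp hπ)
    (by rwa [LinearEquiv.ker_comp])
  have : Injective (g ∘ₗ f) := OrzechProperty.injective_of_surjective_endomorphism _ (hg.comp hf)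
  exact ⟨LinearEquiv.ofBijective f ⟨Injective.of_comp this, hf⟩⟩

lemma exists_hasTop (hA : IsSemisimpleModule A (A ⧸ Module.jacobson A A)) :
    ∃ (k : ℕ) (S : Fin k → Submodule A (A ⧸ Module.jacobson A A)),
      ∀ (P : Type) [AddCommGroup P] [Module A P] [Module.Finite A P]
        [IsSemisimpleModule A (P ⧸ Module.jacobson A P)],
        ∃ n, HasTop A (fun j ↦ S j) P n := by
  obtain ⟨k, S, e, hS⟩ := IsSemisimpleModule.exists_linearEquiv_fin_dfinsupp A
    (A ⧸ Module.jacobson A A)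
  refine ⟨k, S, fun P _ _ _ _ ↦ ?_⟩
  have simple (L : Type) [AddCommGroup L] [Module A L] [IsSimpleModule A L] :
      ∃ j, Nonempty (L ≃ₗ[A] S j) := by
    have := IsSimpleModule.nontrivial A L
    obtain ⟨x, hx⟩ := exists_ne (0 : L)
    have hle : Module.jacobson A A ≤ LinearMap.ker (LinearMap.toSpanSingleton A L x) :=
      (Module.le_comap_jacobson _).trans
        (by rw [IsSemisimpleModule.jacobson_eq_bot A L]; rfl)
    let q := (Submodule.liftQ _ _ hle) ∘ₗ e.symm.toLinearMap
    have hq : q ≠ 0 := fun h ↦ hx (by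
      rw [← one_smul A x, ← LinearMap.toSpanSingleton_apply A, ← Submodule.liftQ_apply _ _ (h := hle),
        ← e.symm_apply_apply (Submodule.Quotient.mk 1)]
      exact LinearMap.congr_fun h _)
    by_contra! hL
    refine hq (DFinsupp.lhom_ext fun j y ↦ ?_)
    rcases LinearMap.bijective_or_eq_zero (q ∘ₗ DFinsupp.lsingle j) with h | h
    · exact (not_nonempty_iff.2 (hL j) ⟨(LinearEquiv.ofBijective _ h).symm⟩).elim
    · exact LinearMap.congr_fun h y
  obtain ⟨m, T, f, hT⟩ := IsSemisimpleModule.exists_linearEquiv_fin_dfinsupp A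
    (P ⧸ Module.jacobson A P)
  choose σ g using fun i ↦ simple (T i)
  let E := f.trans ((DFinsupp.linearEquivFunOnFintype (R := A) (M := fun i ↦ T i)).trans
    (LinearEquiv.piCongrRight fun i ↦ (g i).some))
  exact ⟨_, Fin m, inferInstance, σ, E.toLinearMap ∘ₗ Submodule.mkQ _,
    E.surjective.comp (Submodule.mkQ_surjective _),
    by rw [LinearEquiv.ker_comp, Submodule.ker_mkQ], rfl⟩

/-- Over a module-finite algebra over a semilocal ring, an additive function takes values in a
finitely generated group on projective modules. -/
theorem fg_projectiveValues [IsNoetherianRing A] {R : Type} [CommRing R] [IsNoetherianRing R]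
    [Algebra R A] [Module.Finite R A] (hR : {I : Ideal R | I.IsMaximal}.Finite)
    {G : Type} [AddCommGroup G] {φ : ∀ (X : Type) [AddCommGroup X] [Module A X], G}
    (hφ : IsAdditiveOn (A := A) (fun _ _ _ ↦ True) φ) : (projectiveValues φ).FG := by
  have hss := @isSemisimpleModule_quotient_jacobson A _ R _ _ _ _ hR
  obtain ⟨k, S, hS⟩ := exists_hasTop (hss A)
  have hprod (P Q : Type) [AddCommGroup P] [Module A P] [AddCommGroup Q] [Module A Q]
      [Module.Finite A P] [Module.Finite A Q] : φ (P × Q) = φ P + φ Q :=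
    hφ _ _ _ (LinearMap.inl A P Q) (LinearMap.snd A P Q) LinearMap.inl_injective
      LinearMap.snd_surjective Exact.inl_snd trivial
  let Γ : Set ((Fin k → ℤ) × G) := {x | ∃ (P : Type) (_ : AddCommGroup P) (_ : Module A P),
    Module.Finite A P ∧ Module.Projective A P ∧ HasTop A (fun j ↦ S j) P x.1 ∧ φ P = x.2}
  have hΓ_add : ∀ x ∈ Γ, ∀ y ∈ Γ, x + y ∈ Γ := by
    rintro x ⟨P, _, _, _, _, hP, hP'⟩ y ⟨Q, _, _, _, _, hQ, hQ'⟩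
    exact ⟨P × Q, _, _, inferInstance, inferInstance, hP.prod hQ, by rw [hprod, hP', hQ']; rfl⟩
  have hΓ_inj : ∀ x ∈ Γ, ∀ y ∈ Γ, x.1 = y.1 → x = y := by
    rintro x ⟨P, _, _, _, _, hP, hP'⟩ y ⟨Q, _, _, _, _, hQ, hQ'⟩ h
    rw [h] at hP
    obtain ⟨e⟩ := hP.nonempty_linearEquiv hQ
    exact Prod.ext h (by rw [← hP', ← hQ', hφ.congr e trivial trivial])
  let H := AddSubgroup.closure Γ
  have hH : ∀ x ∈ H, ∃ y ∈ Γ, ∃ z ∈ Γ, x = y - z := by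
    intro x hx
    induction hx using AddSubgroup.closure_induction with
    | mem x hx => exact ⟨x + x, hΓ_add x hx x hx, x, hx, by simp⟩
    | zero =>
      obtain ⟨n, hn⟩ := @hS A _ _ _ (hss A)
      have : (n, φ A) ∈ Γ := ⟨A, _, _, inferInstance, inferInstance, hn, rfl⟩
      exact ⟨_, this, _, this, (sub_self _).symm⟩
    | add x y _ _ hx hy =>
      obtain ⟨a, ha, b, hb, rfl⟩ := hx
      obtain ⟨c, hc, d, hd, rfl⟩ := hy
      exact ⟨_, hΓ_add a ha c hc, _, hΓ_add b hb d hd, sub_add_sub_comm _ _ _ _⟩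
    | neg x _ hx =>
      obtain ⟨a, ha, b, hb, rfl⟩ := hx
      exact ⟨b, hb, a, ha, neg_sub _ _⟩
  let p : H →+ (Fin k → ℤ) := (AddMonoidHom.fst _ _).comp H.subtype
  have hp : Injective p := by
    refine (injective_iff_map_eq_zero p).2 fun ⟨x, hx⟩ hx0 ↦ Subtype.ext ?_
    obtain ⟨y, hy, z, hz, rfl⟩ := hH x hx
    exact sub_eq_zero.2 (hΓ_inj y hy z hz (sub_eq_zero.1 hx0))
  have : Module.Finite ℤ H := Module.Finite.of_injective p.toIntLinearMap hp
  have hHfg : AddGroup.FG H := Module.Finite.iff_addGroup_fg.1 this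
  have : projectiveValues φ = H.map (AddMonoidHom.snd _ _) := by
    rw [AddMonoidHom.map_closure, projectiveValues]
    congr 1
    ext c
    constructor
    · rintro ⟨P, _, _, _, _, rfl⟩
      obtain ⟨n, hn⟩ := @hS P _ _ _ (hss P)
      exact ⟨(n, φ P), ⟨P, _, _, inferInstance, inferInstance, hn, rfl⟩, rfl⟩
    · rintro ⟨x, ⟨P, _, _, h₁, h₂, _, h₃⟩, rfl⟩
      exact ⟨P, _, _, h₁, h₂, h₃⟩
  rw [this, ← AddSubgroup.range_subtype H, ← AddMonoidHom.range_comp]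
  exact (AddGroup.fg_iff_addSubgroup_fg _).1 (AddGroup.fg_range _)

end Semilocal

section AlmostIdempotent

open Function

variable {R : Type} [CommRing R] [IsNoetherianRing R] {G : Type} [AddCommGroup G]
  {c : ∀ (Y : Type) [AddCommGroup Y] [Module R Y], G} {r : R}

lemma IsAdditiveOn.eq_of_smul_mem (hc : IsAdditiveOn (A := R) (fun _ _ _ ↦ True) c)
    (hr : ∀ (T : Type) [AddCommGroup T] [Module R T] [Module.Finite R T],
      (∀ t : T, r • t = 0) → c T = 0)
    {Y : Type} [AddCommGroup Y] [Module R Y] [Module.Finite R Y] {N N' : Submodule R Y}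
    (h : N ≤ N') (hN : ∀ y ∈ N', r • y ∈ N) : c N = c N' := by
  let ι := Submodule.inclusion h
  rw [hc _ _ (N' ⧸ LinearMap.range ι) ι (Submodule.mkQ _) (Submodule.inclusion_injective h)
    (Submodule.mkQ_surjective _) (LinearMap.exact_map_mkQ_range ι) trivial,
    hr (N' ⧸ LinearMap.range ι) ?_, add_zero]
  intro t
  obtain ⟨t, rfl⟩ := Submodule.mkQ_surjective _ t
  exact (Submodule.Quotient.mk_eq_zero _).2 ⟨⟨r • t.1, hN _ t.2⟩, rfl⟩

variable {A : Type} [Ring A] [Algebra R A]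

/-- The value of `c` on the image of multiplication by `a` on an `A`-module, considered as an
`R`-module. -/
noncomputable def valueOfImage (c : ∀ (Y : Type) [AddCommGroup Y] [Module R Y], G) (a : A)
    (X : Type) [AddCommGroup X] [Module A X] : G :=
  let _ : Module R X := Module.compHom X (algebraMap R A)
  have : IsScalarTower R A X := isScalarTower_compHom X
  c (LinearMap.range (Algebra.lsmul R R X a))

omit [IsNoetherianRing R] [AddCommGroup G] in
lemma valueOfImage_eq (a : A) (X : Type) [AddCommGroup X] [Module A X] [inst : Module R X]
    [IsScalarTower R A X] :
    valueOfImage c a X = c (LinearMap.range (Algebra.lsmul R R X a)) := by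
  have h : inst = Module.compHom X (algebraMap R A) :=
    Module.ext' _ _ fun s x ↦ (algebraMap_smul A s x).symm
  subst h
  rfl

lemma isAdditiveOn_valueOfImage [Module.Finite R A]
    (hc : IsAdditiveOn (A := R) (fun _ _ _ ↦ True) c)
    (hr : ∀ (T : Type) [AddCommGroup T] [Module R T] [Module.Finite R T],
      (∀ t : T, r • t = 0) → c T = 0)
    {a : A} (ha : a * a = r • a) :
    IsAdditiveOn (A := A) (fun _ _ _ ↦ True) (fun X _ _ ↦ valueOfImage c a X) := by
  intro X Y Z _ _ _ _ _ _ _ f g hf hg hfg _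
  have tower {W : Type} [AddCommGroup W] [Module A W] :
      ∃ _ : Module R W, IsScalarTower R A W :=
    ⟨Module.compHom W (algebraMap R A), isScalarTower_compHom W⟩
  obtain ⟨_, _⟩ := @tower X _ _
  obtain ⟨_, _⟩ := @tower Y _ _
  obtain ⟨_, _⟩ := @tower Z _ _
  have : Module.Finite R Y := Module.Finite.trans A Y
  change valueOfImage c a Y = valueOfImage c a X + valueOfImage c a Z
  rw [valueOfImage_eq, valueOfImage_eq, valueOfImage_eq]
  let f' : X →ₗ[R] Y := f.restrictScalars R
  let g' : Y →ₗ[R] Z := g.restrictScalars R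
  have : Module.Finite R X := Module.Finite.of_injective f' hf
  let aX := LinearMap.range (Algebra.lsmul R R X a)
  let aY := LinearMap.range (Algebra.lsmul R R Y a)
  let aZ := LinearMap.range (Algebra.lsmul R R Z a)
  change c aY = c aX + c aZ
  have hX : c aX = c (aX.map f') :=
    hc.congr (Submodule.equivMapOfInjective f' hf aX) trivial trivial
  have hX' : c (aX.map f') = c (aY ⊓ LinearMap.ker g' : Submodule R Y) := by
    refine hc.eq_of_smul_mem hr ?_ ?_
    · rintro _ ⟨_, ⟨x, rfl⟩, rfl⟩
      exact ⟨⟨f x, (map_smul f a x).symm⟩, hfg.apply_apply_eq_zero _⟩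
    · rintro _ ⟨⟨y, rfl⟩, hy⟩
      obtain ⟨x, hx⟩ := (hfg _).1 hy
      refine ⟨a • x, ⟨x, rfl⟩, ?_⟩
      change f (a • x) = r • a • y
      rw [map_smul, hx, ← smul_assoc, ← ha, mul_smul]
      rfl
  let G' : aY →ₗ[R] aZ := g'.restrict (by
    rintro _ ⟨y, rfl⟩
    exact ⟨g y, (map_smul g a y).symm⟩)
  rw [hX, hX']
  refine hc _ _ _ (Submodule.inclusion inf_le_left) G' (Submodule.inclusion_injective _) ?_ ?_
    trivial
  · rintro ⟨_, z, rfl⟩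
    obtain ⟨y, rfl⟩ := hg z
    exact ⟨⟨a • y, y, rfl⟩, Subtype.ext (map_smul g a y)⟩
  · rintro ⟨y, hy⟩
    constructor
    · intro h
      exact ⟨⟨y, hy, congrArg Subtype.val h⟩, rfl⟩
    · rintro ⟨⟨z, hz, hz'⟩, h⟩
      cases h
      exact Subtype.ext hz'

end AlmostIdempotent

section DivisorClassGroup

open Function

variable {R : Type} [CommRing R] [IsDomain R] [IsNoetherianRing R] {M : Type} [AddCommGroup M]
  [Module R M]

lemma exists_linearMap_apply_ne_zero [Module.Finite R M] [FaithfulSMul R M] :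
    ∃ (f : M →ₗ[R] R) (m : M), f m ≠ 0 := by
  have hM : ¬ Module.IsTorsion R M := fun h ↦ by
    obtain ⟨s, hs, hs'⟩ := exists_smul_eq_zero_of_isTorsion h
    exact hs (FaithfulSMul.eq_of_smul_eq_smul (α := M) fun x ↦ by rw [hs', zero_smul])
  obtain ⟨m, hm⟩ := exists_smul_eq_zero_imp_of_not_isTorsion hM
  let K := FractionRing R
  let S := nonZeroDivisors R
  let V := LocalizedModule S M
  have hv : LocalizedModule.mkLinearMap S M m ≠ 0 := fun h ↦ by
    obtain ⟨s, hs⟩ := (IsLocalizedModule.eq_zero_iff S (LocalizedModule.mkLinearMap S M)).1 h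
    exact nonZeroDivisors.coe_ne_zero s (hm s hs)
  obtain ⟨g, hg⟩ : ∃ g : Module.Dual K V, g (LocalizedModule.mkLinearMap S M m) ≠ 0 := by
    by_contra! h
    exact hv ((Module.forall_dual_apply_eq_zero_iff K _).1 h)
  have := Module.finitePresentation_of_finite R M
  obtain ⟨f, s, hf⟩ := Module.FinitePresentation.exists_lift_of_isLocalizedModule S
    (Algebra.linearMap R K) (g.restrictScalars R ∘ₗ LocalizedModule.mkLinearMap S M)
  refine ⟨f, m, fun h ↦ hg ?_⟩
  have hs : s.1 • g (LocalizedModule.mkLinearMap S M m) = 0 := by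
    have := LinearMap.congr_fun hf m
    rw [LinearMap.comp_apply, h, map_zero] at this
    exact this.symm
  rw [Algebra.smul_def, mul_eq_zero] at hs
  exact hs.resolve_left fun h0 ↦ nonZeroDivisors.coe_ne_zero s
    (IsFractionRing.injective R K (h0.trans (map_zero _).symm))

/-- The endomorphism `x ↦ f x • m`. -/
def rankOneEnd (f : M →ₗ[R] R) (m : M) : Module.End R M :=
  LinearMap.toSpanSingleton R M m ∘ₗ f

omit [IsDomain R] [IsNoetherianRing R] in
lemma rankOneEnd_mul_self (f : M →ₗ[R] R) (m : M) :
    rankOneEnd f m * rankOneEnd f m = f m • rankOneEnd f m := by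
  ext x
  change f (f x • m) • m = f m • f x • m
  rw [map_smul, smul_smul, smul_eq_mul, mul_comm]

omit [IsDomain R] in
lemma exists_valueOfImage_eq [Module.Finite R M] {G : Type} [AddCommGroup G]
    {c : ∀ (Y : Type) [AddCommGroup Y] [Module R Y], G}
    (hc : IsAdditiveOn (A := R) (fun _ _ _ ↦ True) c) (f : M →ₗ[R] R) (m : M)
    (hr : ∀ (T : Type) [AddCommGroup T] [Module R T] [Module.Finite R T],
      (∀ t : T, f m • t = 0) → c T = 0) (p : Ideal R) [hpp : p.IsPrime] (hp : f m ∉ p) :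
    ∃ N : Submodule (Module.End R M) M, valueOfImage c (rankOneEnd f m) (M ⧸ N) = c (R ⧸ p) := by
  have smul_mem (a : Module.End R M) {x : M} (hx : x ∈ p • (⊤ : Submodule R M)) :
      a x ∈ p • (⊤ : Submodule R M) := by
    have := Submodule.mem_map_of_mem (f := a) hx
    rw [Submodule.map_smul''] at this
    exact Submodule.smul_mono le_rfl le_top this
  let N : Submodule (Module.End R M) M :=
    { (p • (⊤ : Submodule R M)).toAddSubmonoid with smul_mem' := fun a x hx ↦ smul_mem a hx }
  refine ⟨N, ?_⟩
  rw [valueOfImage_eq]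
  let x : M ⧸ N := Submodule.Quotient.mk m
  have : Module.Finite R (M ⧸ N) :=
    Module.Finite.of_surjective (N.mkQ.restrictScalars R) (Submodule.mkQ_surjective N)
  have hrange (y : M) : rankOneEnd f m • (Submodule.Quotient.mk y : M ⧸ N) = f y • x := rfl
  rw [hc.eq_of_smul_mem hr (N' := LinearMap.range (LinearMap.toSpanSingleton R (M ⧸ N) x))]
  · refine hc.congr ((LinearMap.quotKerEquivRange _).symm.trans
      (Submodule.quotEquivOfEq _ _ ?_)) trivial trivial
    ext t
    rw [LinearMap.mem_ker, LinearMap.toSpanSingleton_apply]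
    change (Submodule.Quotient.mk (t • m) : M ⧸ N) = 0 ↔ _
    rw [Submodule.Quotient.mk_eq_zero]
    change t • m ∈ p • (⊤ : Submodule R M) ↔ _
    refine ⟨fun h ↦ ?_, fun h ↦ Submodule.smul_mem_smul h trivial⟩
    have h' := Submodule.mem_map_of_mem (f := f) h
    rw [Submodule.map_smul'', map_smul] at h'
    exact (hpp.mem_or_mem (Ideal.mul_le_left (I := p) (J := Submodule.map f ⊤) h')).resolve_right hp
  · rintro _ ⟨y, rfl⟩
    obtain ⟨y, rfl⟩ := Submodule.Quotient.mk_surjective _ y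
    exact ⟨f y, (hrange y).symm⟩
  · rintro _ ⟨t, rfl⟩
    refine ⟨Submodule.Quotient.mk (t • m), ?_⟩
    change rankOneEnd f m • (Submodule.Quotient.mk (t • m) : M ⧸ N) = f m • t • x
    rw [hrange, map_smul, smul_smul, smul_eq_mul, mul_comm]

lemma torsionDivisor_mem_span {s : R} (hs : s ≠ 0) {T : Type} [AddCommGroup T] [Module R T]
    (h : ∀ t : T, s • t = 0) : torsionDivisor T ∈
      Submodule.span ℤ ((fun p ↦ Finsupp.single p (1 : ℤ)) ''
        {p : HeightOnePrime R | s ∈ p.1.asIdeal}) := by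
  rw [← Finsupp.sum_single (torsionDivisor T)]
  refine Submodule.sum_mem _ fun p hp ↦ ?_
  have hsp : s ∈ p.1.asIdeal := by
    by_contra hsp
    refine Finsupp.mem_support_iff.1 hp ?_
    rw [torsionDivisor_apply hs h, p.mult_eq_zero hsp h, Nat.cast_zero]
  rw [← mul_one (torsionDivisor T p), ← smul_eq_mul, ← Finsupp.smul_single]
  exact Submodule.smul_mem _ _ (Submodule.subset_span ⟨p, hsp, rfl⟩)

end DivisorClassGroup

/-- Let `R` be a noetherian semilocal normal domain admitting a non-commutative
resolution, i.e. a finitely generated faithful module `M` such that `End_R(M)` has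
finite global dimension.  Then the divisor class group `Cl(R)` is a finitely
generated abelian group. -/
theorem statement9 (R : Type) [CommRing R] [IsDomain R] [IsIntegrallyClosed R]
    [IsNoetherianRing R] (hsemilocal : {I : Ideal R | I.IsMaximal}.Finite)
    (M : Type) [AddCommGroup M] [Module R M] [Module.Finite R M] [FaithfulSMul R M]
    (hNCR : HasFiniteGlobalDim (Module.End R M)) :
    AddGroup.FG (DivClassGroup R) := by
  obtain ⟨f, m, hr⟩ := exists_linearMap_apply_ne_zero (R := R) (M := M)
  let F : Submodule ℤ (DivClassGroup R) := (Submodule.span ℤ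
    ((fun p ↦ Finsupp.single p (1 : ℤ)) '' {p : HeightOnePrime R | f m ∈ p.1.asIdeal})).map
      (QuotientAddGroup.mk' (principalDivisors R)).toIntLinearMap
  have hF : Module.Finite ℤ F := Module.Finite.iff_fg.2
    ((Submodule.fg_span ((HeightOnePrime.finite_setOf_mem hr).image _)).map _)
  let cl : (HeightOnePrime R →₀ ℤ) →ₗ[ℤ] DivClassGroup R ⧸ F :=
    F.mkQ ∘ₗ (QuotientAddGroup.mk' (principalDivisors R)).toIntLinearMap
  have cl_principal {D : HeightOnePrime R →₀ ℤ} (hD : D ∈ principalDivisors R) : cl D = 0 := by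
    have : QuotientAddGroup.mk' (principalDivisors R) D = 0 :=
      (QuotientAddGroup.eq_zero_iff D).2 hD
    change F.mkQ (QuotientAddGroup.mk' (principalDivisors R) D) = 0
    rw [this, map_zero]
  have cl_span {D : HeightOnePrime R →₀ ℤ} (hD : D ∈ Submodule.span ℤ
      ((fun p ↦ Finsupp.single p (1 : ℤ)) '' {p : HeightOnePrime R | f m ∈ p.1.asIdeal})) :
      cl D = 0 := (Submodule.Quotient.mk_eq_zero F).2 (Submodule.mem_map_of_mem hD)
  obtain ⟨c, hc, hcD⟩ := exists_additive_extension (R := R)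
    (fun T _ _ ↦ cl (torsionDivisor T))
    (fun X Y Z _ _ _ _ _ _ _ f g hf hg hfg hY ↦ by
      change cl (torsionDivisor Y) = cl (torsionDivisor X) + cl (torsionDivisor Z)
      rw [← map_add]
      exact congrArg cl (isAdditiveOn_torsionDivisor X Y Z f g hf hg hfg hY))
    (fun a ha ↦ cl_principal (torsionDivisor_span_singleton ha))
  have torsion {T : Type} [AddCommGroup T] [Module R T] {s : R} (hs : s ≠ 0)
      (h : ∀ t : T, s • t = 0) : Module.IsTorsion R T := fun {t} ↦
    ⟨⟨s, mem_nonZeroDivisors_of_ne_zero hs⟩, h t⟩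
  have hc₀ (T : Type) [AddCommGroup T] [Module R T] [Module.Finite R T]
      (h : ∀ t : T, f m • t = 0) : c T = 0 := by
    rw [hcD T (torsion hr h)]
    exact cl_span (torsionDivisor_mem_span hr h)
  have : Module.Finite R (Module.End R M) := inferInstance
  have : IsNoetherianRing (Module.End R M) := isNoetherian_of_tower R
    (inferInstanceAs (IsNoetherian R (M →ₗ[R] M)))
  have hφ := isAdditiveOn_valueOfImage hc hc₀ (rankOneEnd_mul_self f m)
  have hfg := fg_projectiveValues (R := R) hsemilocal hφ
  have htop : projectiveValues (A := Module.End R M)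
      (fun X _ _ ↦ valueOfImage c (rankOneEnd f m) X) = ⊤ := by
    refine (AddSubgroup.eq_top_iff' _).2 fun x ↦ ?_
    obtain ⟨x, rfl⟩ := F.mkQ_surjective x
    obtain ⟨D, rfl⟩ := QuotientAddGroup.mk'_surjective _ x
    change cl D ∈ _
    induction D using Finsupp.induction_linear with
    | zero => rw [map_zero]; exact zero_mem _
    | add D E hD hE => rw [map_add]; exact add_mem hD hE
    | single p n =>
      rw [← mul_one n, ← smul_eq_mul, ← Finsupp.smul_single, map_smul]
      refine zsmul_mem ?_ n
      by_cases hp : f m ∈ p.1.asIdeal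
      · rw [cl_span (Submodule.subset_span ⟨p, hp, rfl⟩)]
        exact zero_mem _
      · obtain ⟨N, hN⟩ := exists_valueOfImage_eq hc f m hc₀ p.1.asIdeal hp
        obtain ⟨s, hs, hs0⟩ := Submodule.exists_mem_ne_zero_of_ne_bot p.ne_bot
        rw [← torsionDivisor_quotient_prime p, ← hcD _ (torsion hs0 ?_), ← hN]
        · have := Module.Finite.of_restrictScalars_finite R (Module.End R M) M
          have := Module.Finite.of_surjective N.mkQ N.mkQ_surjective
          exact hNCR.mem_projectiveValues hφ (M ⧸ N)
        · intro t
          obtain ⟨t, rfl⟩ := Submodule.mkQ_surjective _ t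
          exact (Submodule.Quotient.mk_eq_zero _).2 (Ideal.mul_mem_right _ _ hs)
  rw [htop, ← AddGroup.fg_def] at hfg
  have : Module.Finite ℤ (DivClassGroup R ⧸ F) := Module.Finite.iff_addGroup_fg.2 hfg
  have := Module.Finite.of_submodule_quotient F
  exact Module.Finite.iff_addGroup_fg.1 this
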